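/- arXiv:1211.3698 — 2 statements merged into one kernel-verified Lean document; each statement's English description precedes it below -/
import Mathlib

section
/- For every θ ∈ (0, π) and every real s ≠ 0, the infimum of ∫_{-θ}^{θ} ((u')² - u²) over u ∈ W₀^{1,2}(-θ,θ) with ∫ u = s is attained, and if θ ≠ π/2 a minimizer is given by u(t) = c(1 - cos t / cos θ) with c = s/(2(θ - tan θ)). -/
open Real MeasureTheory Set intervalIntegral

/-- `u ∈ W^{1,2}_0(-θ,θ)` with weak derivative `u'`: `u'` and `(u')^2` are
integrable on `(-θ,θ)`, `u` is the primitive of `u'` starting from `-θ`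
(hence absolutely continuous with `u(-θ)=0`), and `u(θ)=0`. -/
def MemW120 (θ : ℝ) (u u' : ℝ → ℝ) : Prop :=
  IntervalIntegrable u' volume (-θ) θ ∧
  IntervalIntegrable (fun t => (u' t)^2) volume (-θ) θ ∧
  (∀ x ∈ Set.Icc (-θ) θ, u x = ∫ t in (-θ)..x, u' t) ∧
  u θ = 0


/-- Auxiliary: `z` absolutely continuous with a.e. derivative `z'`, square integrable. -/
structure HW (z z' : ℝ → ℝ) (a b : ℝ) : Prop where
  ac : AbsolutelyContinuousOnInterval z a b
  der : ∀ᵐ x, x ∈ uIcc a b → HasDerivAt z (z' x) x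
  int : IntervalIntegrable z' volume a b
  sq : IntervalIntegrable (fun t => (z' t)^2) volume a b

lemma HW.mono {z z' : ℝ → ℝ} {a b c d : ℝ} (h : HW z z' a b) (hs : uIcc c d ⊆ uIcc a b) :
    HW z z' c d where
  ac := h.ac.mono hs
  der := by filter_upwards [h.der] with x hx hx' using hx (hs hx')
  int := h.int.mono_set hs
  sq := h.sq.mono_set hs

lemma ac_ftc {F F' : ℝ → ℝ} {a b : ℝ} (h : AbsolutelyContinuousOnInterval F a b)
    (hd : ∀ᵐ x, x ∈ uIcc a b → HasDerivAt F (F' x) x) :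
    ∫ x in a..b, F' x = F b - F a := by
  rw [← h.integral_deriv_eq_sub]
  apply intervalIntegral.integral_congr_ae
  filter_upwards [hd] with x hx hx'
  exact (hx (uIoc_subset_uIcc hx')).deriv.symm

lemma HW.picone {z z' : ℝ → ℝ} {a b c : ℝ} (h : HW z z' a b) (hab : a ≤ b)
    (hc : ∀ t ∈ uIcc a b, cos (t - c) ≠ 0) :
    -(z b ^ 2 * tan (b - c) - z a ^ 2 * tan (a - c)) ≤
      ∫ t in a..b, ((z' t)^2 - (z t)^2) := by
  have hT : ContDiffOn ℝ 1 (fun t => tan (t - c)) (uIcc a b) := by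
    intro t ht
    have h1 : ContDiffAt ℝ 1 tan (t - c) := Real.contDiffAt_tan.2 (hc t ht)
    have h2 : ContDiffAt ℝ 1 (fun t : ℝ => t - c) t := by fun_prop
    exact (ContDiffAt.comp t h1 h2).contDiffWithinAt
  have hTc := hT.continuousOn
  have hzc := h.ac.continuousOn
  have hF : AbsolutelyContinuousOnInterval (fun t => z t * z t * tan (t - c)) a b :=
    (h.ac.fun_mul h.ac).fun_mul hT.absolutelyContinuousOnInterval
  have hi1 : IntervalIntegrable (fun t => z' t * (2 * z t * tan (t - c))) volume a b :=
    h.int.mul_continuousOn (by fun_prop)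
  have hi2 : IntervalIntegrable (fun t => z t ^ 2 * (1 + tan (t - c) ^ 2)) volume a b :=
    ContinuousOn.intervalIntegrable (by fun_prop)
  have hi3 : IntervalIntegrable (fun t => z t ^ 2) volume a b :=
    ContinuousOn.intervalIntegrable (by fun_prop)
  have key := ac_ftc (F' := fun t => z' t * (2 * z t * tan (t - c)) +
      z t ^ 2 * (1 + tan (t - c) ^ 2)) hF (by
    filter_upwards [h.der] with x hx hx'
    have hcx := hc x hx'
    have h1 : HasDerivAt (fun t => tan (t - c)) (1 / cos (x - c) ^ 2) x :=
      (Real.hasDerivAt_tan hcx).comp_sub_const x c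
    have h2 := ((hx hx').fun_mul (hx hx')).fun_mul h1
    refine h2.congr_deriv ?_
    rw [tan_eq_sin_div_cos]
    field_simp
    have := sin_sq_add_cos_sq (x - c)
    linear_combination (-(z x) ^ 2) * this)
  have hpos : 0 ≤ ∫ t in a..b, (z' t + z t * tan (t - c)) ^ 2 :=
    intervalIntegral.integral_nonneg hab (fun t _ => sq_nonneg _)
  have e : ∫ t in a..b, (z' t + z t * tan (t - c)) ^ 2 =
      (∫ t in a..b, ((z' t)^2 - (z t)^2)) + ∫ t in a..b, (z' t * (2 * z t * tan (t - c)) +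
      z t ^ 2 * (1 + tan (t - c) ^ 2)) := by
    rw [← intervalIntegral.integral_add (h.sq.sub hi3) (hi1.add hi2)]
    congr 1
    ext t
    ring
  rw [e, key] at hpos
  nlinarith

lemma HW.wirtinger {w w' : ℝ → ℝ} {θ : ℝ} (h : HW w w' (-θ) θ) (h0 : 0 < θ) (hπ : θ < π)
    (hl : w (-θ) = 0) (hr : w θ = 0) (hm : ∫ t in (-θ)..θ, w t = 0) :
    0 ≤ ∫ t in (-θ)..θ, ((w' t)^2 - (w t)^2) := by
  have hu : uIcc (-θ) θ = Icc (-θ) θ := uIcc_of_le (by linarith)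
  have hwc : ContinuousOn w (Icc (-θ) θ) := hu ▸ h.ac.continuousOn
  have hx : ∃ x ∈ Icc (-θ) 0, w x - w (x + θ) = 0 := by
    have hc : ContinuousOn (fun x => w x - w (x + θ)) (uIcc (-θ) 0) := by
      rw [uIcc_of_le (by linarith)]
      refine (hwc.mono (Icc_subset_Icc le_rfl h0.le)).sub (hwc.comp (by fun_prop) ?_)
      intro x hx
      constructor <;> linarith [hx.1, hx.2]
    have := intermediate_value_uIcc hc
    have h0m : (0:ℝ) ∈ uIcc (w (-θ) - w (-θ + θ)) (w 0 - w (0 + θ)) := by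
      rw [mem_uIcc]; simp only [hl, hr, neg_add_cancel, zero_add]
      rcases le_total (w 0) 0 with h | h
      · right; constructor <;> linarith
      · left; constructor <;> linarith
    obtain ⟨x, hx, hx'⟩ := this h0m
    rw [uIcc_of_le (by linarith)] at hx
    exact ⟨x, hx, hx'⟩
  obtain ⟨x, ⟨hx1, hx2⟩, hxw⟩ := hx
  set m := w x with hmdef
  have hz : HW (fun t => w t - m) w' (-θ) θ := by
    refine ⟨h.ac.fun_sub (ContDiffOn.absolutelyContinuousOnInterval contDiffOn_const), ?_,
      h.int, h.sq⟩
    filter_upwards [h.der] with y hy hy' using (hy hy').sub_const m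
  have hcos : ∀ y : ℝ, -(π/2) < y → y < π/2 → cos y ≠ 0 :=
    fun y h1 h2 => (cos_pos_of_mem_Ioo ⟨h1, h2⟩).ne'
  have s1 : uIcc (-θ) x ⊆ uIcc (-θ) θ := by
    rw [hu, uIcc_of_le hx1]; exact Icc_subset_Icc le_rfl (by linarith)
  have s2 : uIcc x (x + θ) ⊆ uIcc (-θ) θ := by
    rw [hu, uIcc_of_le (by linarith)]; exact Icc_subset_Icc hx1 (by linarith)
  have s3 : uIcc (x + θ) θ ⊆ uIcc (-θ) θ := by
    rw [hu, uIcc_of_le (by linarith)]; exact Icc_subset_Icc (by linarith) le_rfl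
  have p1 := (hz.mono s1).picone hx1 (c := x - θ/2) (by
    intro t ht
    rw [uIcc_of_le hx1] at ht
    apply hcos <;> linarith [ht.1, ht.2])
  have p2 := (hz.mono s2).picone (by linarith) (c := x + θ/2) (by
    intro t ht
    rw [uIcc_of_le (by linarith)] at ht
    apply hcos <;> linarith [ht.1, ht.2])
  have p3 := (hz.mono s3).picone (by linarith) (c := x + 3*θ/2) (by
    intro t ht
    rw [uIcc_of_le (by linarith)] at ht
    apply hcos <;> linarith [ht.1, ht.2])
  have hi : ContinuousOn w (uIcc (-θ) θ) := h.ac.continuousOn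
  have hint : IntervalIntegrable (fun t => (w' t)^2 - (w t - m)^2) volume (-θ) θ :=
    h.sq.sub (ContinuousOn.intervalIntegrable (by fun_prop))
  have e1 := intervalIntegral.integral_add_adjacent_intervals
    (hint.mono_set s1) (hint.mono_set s2)
  have e2 := intervalIntegral.integral_add_adjacent_intervals
    ((hint.mono_set s1).trans (hint.mono_set s2)) (hint.mono_set s3)
  have hwi : IntervalIntegrable w volume (-θ) θ := hi.intervalIntegrable
  have e3 : ∫ t in (-θ)..θ, ((w' t)^2 - (w t - m)^2) =
      (∫ t in (-θ)..θ, ((w' t)^2 - (w t)^2)) + 2 * m * (∫ t in (-θ)..θ, w t) - 2 * θ * m^2 := by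
    have e4 : ∫ t in (-θ)..θ, m ^ 2 = 2 * θ * m^2 := by
      rw [intervalIntegral.integral_const, smul_eq_mul]; ring
    rw [← e4, ← intervalIntegral.integral_const_mul, ← intervalIntegral.integral_add,
      ← intervalIntegral.integral_sub]
    · congr 1; ext t; ring
    · exact (h.sq.sub (ContinuousOn.intervalIntegrable (by fun_prop))).add (hwi.const_mul _)
    · simp
    · exact h.sq.sub (ContinuousOn.intervalIntegrable (by fun_prop))
    · exact hwi.const_mul _
  rw [hm] at e3
  have hxθ : w (x + θ) = m := by linarith
  have t1 : (-θ - (x - θ/2)) = (θ - (x + 3*θ/2)) := by ring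
  simp only [hl, hr, hxθ, ← hmdef, t1] at p1 p2 p3
  have : 0 ≤ 2 * θ * m^2 := by positivity
  linarith

lemma coef_pos {θ : ℝ} (hθ : θ ∈ Set.Ioo 0 π) : 0 < sin θ - θ * cos θ := by
  have hs := sin_pos_of_mem_Ioo hθ
  obtain ⟨h0, hp⟩ := hθ
  rcases lt_or_ge θ (π/2) with h | h
  · have hc : 0 < cos θ := cos_pos_of_mem_Ioo ⟨by linarith, h⟩
    have := Real.lt_tan h0 h
    rw [tan_eq_sin_div_cos, lt_div_iff₀ hc] at this
    linarith
  · have hc : cos θ ≤ 0 := cos_nonpos_of_pi_div_two_le_of_le h (by linarith)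
    nlinarith

lemma U_mem (θ a : ℝ) : MemW120 θ (fun t => a * (cos t - cos θ)) (fun t => a * (-sin t)) := by
  refine ⟨Continuous.intervalIntegrable (by fun_prop) _ _,
    Continuous.intervalIntegrable (by fun_prop) _ _, ?_, by simp⟩
  intro x _
  rw [intervalIntegral.integral_const_mul, intervalIntegral.integral_neg, integral_sin, cos_neg]
  ring

lemma U_int {θ s : ℝ} (hθ : θ ∈ Set.Ioo 0 π) :
    ∫ t in (-θ)..θ, s / (2 * (sin θ - θ * cos θ)) * (cos t - cos θ) = s := by
  have := coef_pos hθ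
  rw [intervalIntegral.integral_const_mul, intervalIntegral.integral_sub
    (Continuous.intervalIntegrable (by fun_prop) _ _) (by simp), integral_cos,
    intervalIntegral.integral_const, sin_neg]
  simp only [smul_eq_mul]
  rw [div_mul_eq_mul_div, div_eq_iff (by positivity)]
  ring

lemma U_min {θ s a : ℝ} (hθ : θ ∈ Set.Ioo 0 π)
    (hU : ∫ t in (-θ)..θ, a * (cos t - cos θ) = s) {v v' : ℝ → ℝ}
    (hv : MemW120 θ v v') (hvs : ∫ t in (-θ)..θ, v t = s) :
    (∫ t in (-θ)..θ, ((a * (-sin t))^2 - (a * (cos t - cos θ))^2)) ≤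
      ∫ t in (-θ)..θ, ((v' t)^2 - (v t)^2) := by
  obtain ⟨h0, hπ⟩ := hθ
  obtain ⟨i1, i2, hv3, hv4⟩ := hv
  have hu : uIcc (-θ) θ = Icc (-θ) θ := uIcc_of_le (by linarith)
  set V : ℝ → ℝ := fun x => ∫ t in (-θ)..x, v' t with hV
  have hVθ : V θ = 0 := by rw [← hv4, hv3 θ ⟨by linarith, le_rfl⟩]
  have hV0 : V (-θ) = 0 := by simp [hV]
  have eqV : ∀ x ∈ uIcc (-θ) θ, v x = V x := fun x hx => hv3 x (hu ▸ hx)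
  have c1 : ∫ t in (-θ)..θ, v t = ∫ t in (-θ)..θ, V t := intervalIntegral.integral_congr eqV
  have c2 : ∫ t in (-θ)..θ, ((v' t)^2 - (v t)^2) = ∫ t in (-θ)..θ, ((v' t)^2 - (V t)^2) := by
    apply intervalIntegral.integral_congr
    intro x hx
    simp only [eqV x hx]
  rw [c2]
  rw [c1] at hvs
  have hVac : AbsolutelyContinuousOnInterval V (-θ) θ :=
    i1.absolutelyContinuousOnInterval_intervalIntegral (by simp)
  have hUac : AbsolutelyContinuousOnInterval (fun t => a * (cos t - cos θ)) (-θ) θ :=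
    ContDiffOn.absolutelyContinuousOnInterval (by fun_prop)
  set w : ℝ → ℝ := fun t => V t - a * (cos t - cos θ) with hw
  set w' : ℝ → ℝ := fun t => v' t - a * (-sin t) with hw'
  have hVc := hVac.continuousOn
  have hW : HW w w' (-θ) θ := by
    refine ⟨hVac.fun_sub hUac, ?_, i1.sub (Continuous.intervalIntegrable (by fun_prop) _ _), ?_⟩
    · filter_upwards [i1.ae_hasDerivAt_integral] with x hx hx'
      have h1 := hx hx' (-θ) (by simp)
      exact h1.fun_sub (((hasDerivAt_cos x).sub_const (cos θ)).const_mul a)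
    · have : (fun t => (w' t)^2) = fun t => (v' t)^2 + v' t * (2 * a * sin t) + (a * sin t)^2 := by
        ext t; simp only [hw']; ring
      rw [this]
      exact (i2.add (i1.mul_continuousOn (by fun_prop))).add
        (Continuous.intervalIntegrable (by fun_prop) _ _)
  have hwc : ContinuousOn w (uIcc (-θ) θ) := hW.ac.continuousOn
  have hwi : IntervalIntegrable w volume (-θ) θ := hwc.intervalIntegrable
  have hwm : ∫ t in (-θ)..θ, w t = 0 := by
    simp only [hw]
    rw [intervalIntegral.integral_sub hVc.intervalIntegrable
      (Continuous.intervalIntegrable (by fun_prop) _ _), hU, hvs, sub_self]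
  have hl : w (-θ) = 0 := by simp [hw, hV0]
  have hr : w θ = 0 := by simp [hw, hVθ]
  have hE := hW.wirtinger h0 hπ hl hr hwm
  have hB := ac_ftc (F := fun t => w t * sin t) (F' := fun t => w' t * sin t + w t * cos t)
    (hW.ac.fun_mul (ContDiffOn.absolutelyContinuousOnInterval (by fun_prop))) (by
      filter_upwards [hW.der] with x hx hx'
      exact (hx hx').fun_mul (hasDerivAt_sin x))
  simp only [hl, hr, zero_mul, sub_zero] at hB
  have j1 : IntervalIntegrable (fun t => (a * (-sin t))^2 - (a * (cos t - cos θ))^2)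
    volume (-θ) θ := Continuous.intervalIntegrable (by fun_prop) _ _
  have j2 : IntervalIntegrable (fun t => (w' t)^2 - (w t)^2) volume (-θ) θ :=
    hW.sq.sub (ContinuousOn.intervalIntegrable (by fun_prop))
  have j3 : IntervalIntegrable (fun t => w' t * sin t + w t * cos t) volume (-θ) θ :=
    (hW.int.mul_continuousOn (by fun_prop)).add (ContinuousOn.intervalIntegrable (by fun_prop))
  have e : ∫ t in (-θ)..θ, ((v' t)^2 - (V t)^2) =
      (∫ t in (-θ)..θ, ((a * (-sin t))^2 - (a * (cos t - cos θ))^2)) +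
      (∫ t in (-θ)..θ, ((w' t)^2 - (w t)^2)) +
      (-2 * a) * (∫ t in (-θ)..θ, (w' t * sin t + w t * cos t)) +
      (2 * a * cos θ) * ∫ t in (-θ)..θ, w t := by
    rw [← intervalIntegral.integral_const_mul, ← intervalIntegral.integral_const_mul,
      ← intervalIntegral.integral_add j1 j2,
      ← intervalIntegral.integral_add (j1.add j2) (j3.const_mul _),
      ← intervalIntegral.integral_add ((j1.add j2).add (j3.const_mul _)) (hwi.const_mul _)]
    congr 1
    ext t
    simp only [hw, hw']
    ring
  rw [e, hB, hwm]
  linarith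

/-- The infimum of ∫ ((u')² - u²) over u ∈ W₀^{1,2}(-θ,θ) with ∫ u = s (s ≠ 0)
is attained, and if θ ≠ π/2 a minimizer is u(t) = c(1 - cos t / cos θ) with
c = s/(2(θ - tan θ)). -/
theorem stmt1 (θ s : ℝ) (hθ : θ ∈ Set.Ioo 0 π) (hs : s ≠ 0) :
    (∃ u u' : ℝ → ℝ, MemW120 θ u u' ∧ (∫ t in (-θ)..θ, u t) = s ∧
      ∀ v v' : ℝ → ℝ, MemW120 θ v v' → (∫ t in (-θ)..θ, v t) = s →
        (∫ t in (-θ)..θ, ((u' t)^2 - (u t)^2)) ≤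
          ∫ t in (-θ)..θ, ((v' t)^2 - (v t)^2)) ∧
    (θ ≠ π/2 →
      MemW120 θ (fun t => (s/(2*(θ - Real.tan θ))) * (1 - Real.cos t / Real.cos θ))
        (fun t => (s/(2*(θ - Real.tan θ))) * (Real.sin t / Real.cos θ)) ∧
      (∫ t in (-θ)..θ, (s/(2*(θ - Real.tan θ))) * (1 - Real.cos t / Real.cos θ)) = s ∧
      ∀ v v' : ℝ → ℝ, MemW120 θ v v' → (∫ t in (-θ)..θ, v t) = s →
        (∫ t in (-θ)..θ, (((s/(2*(θ - Real.tan θ))) * (Real.sin t / Real.cos θ))^2 -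
            ((s/(2*(θ - Real.tan θ))) * (1 - Real.cos t / Real.cos θ))^2)) ≤
          ∫ t in (-θ)..θ, ((v' t)^2 - (v t)^2)) := by
  refine ⟨⟨_, _, U_mem θ (s / (2 * (sin θ - θ * cos θ))), U_int hθ,
    fun v v' hv hvs => U_min hθ (U_int hθ) hv hvs⟩, ?_⟩
  intro hne
  have hpos := coef_pos hθ
  have hc : cos θ ≠ 0 := by
    intro h
    apply hne
    apply injOn_cos ⟨hθ.1.le, hθ.2.le⟩ ⟨by positivity, by linarith [pi_pos]⟩
    rw [h, cos_pi_div_two]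
  have hd : s / (2 * (θ - tan θ)) = -(s / (2 * (sin θ - θ * cos θ))) * cos θ := by
    have h1 : θ - tan θ = -(sin θ - θ * cos θ) / cos θ := by
      rw [tan_eq_sin_div_cos]
      field_simp
      ring
    rw [h1]
    field_simp
  have e1 : ∀ t, (s/(2*(θ - Real.tan θ))) * (1 - Real.cos t / Real.cos θ) =
      s / (2 * (sin θ - θ * cos θ)) * (cos t - cos θ) := by
    intro t
    rw [hd]
    generalize s / (2 * (sin θ - θ * cos θ)) = a
    field_simp
    ring
  have e2 : ∀ t, (s/(2*(θ - Real.tan θ))) * (Real.sin t / Real.cos θ) =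
      s / (2 * (sin θ - θ * cos θ)) * (-sin t) := by
    intro t
    rw [hd]
    generalize s / (2 * (sin θ - θ * cos θ)) = a
    field_simp
  simp only [e1, e2]
  exact ⟨U_mem θ _, U_int hθ, fun v v' hv hvs => U_min hθ (U_int hθ) hv hvs⟩
end

section
/- For every λ ∈ (0,1), θ ∈ (0,π), M > 0, and u ∈ W₀^{1,2}(-θ,θ) satisfying (∫ u)² ≤ (1/M) ∫ u², one has (1-λ)∫ (u')² - ∫ u² ≥ (π/θ)·((π/θ)(1-λ) - θ/π - π(1-λ)/(2θ²M)) ∫ u². -/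
open Real MeasureTheory Set intervalIntegral

/-- Integration by parts of the weak derivative against a smooth function. -/
lemma memW_parts {θ : ℝ} {u u' : ℝ → ℝ} (h0 : 0 < θ) (hu : MemW120 θ u u')
    (g g' : ℝ → ℝ) (hg : ContDiff ℝ 1 g) (hg' : deriv g = g') :
    ∫ x in (-θ)..θ, g x * u' x = - ∫ x in (-θ)..θ, g' x * u x := by
  obtain ⟨h1, -, h3, h4⟩ := hu
  have hle : -θ ≤ θ := by linarith
  have hac := h1.absolutelyContinuousOnInterval_intervalIntegral (c := -θ) left_mem_uIcc
  have hgac : AbsolutelyContinuousOnInterval g (-θ) θ :=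
    ContDiffOn.absolutelyContinuousOnInterval hg.contDiffOn
  have key := hgac.integral_mul_deriv_eq_deriv_mul hac
  have e0 : (∫ v in (-θ)..θ, u' v) = 0 := by
    rw [← h3 θ ⟨hle, le_rfl⟩, h4]
  rw [e0, intervalIntegral.integral_same] at key
  have e1 : ∫ x in (-θ)..θ, g x * u' x =
      ∫ x in (-θ)..θ, g x * deriv (fun x ↦ ∫ v in (-θ)..x, u' v) x := by
    apply intervalIntegral.integral_congr_ae
    filter_upwards [h1.ae_hasDerivAt_integral] with x hx hx2
    rw [(hx (uIoc_subset_uIcc hx2) (-θ) left_mem_uIcc).deriv]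
  have e2 : ∫ x in (-θ)..θ, g' x * u x =
      ∫ x in (-θ)..θ, deriv g x * (∫ v in (-θ)..x, u' v) := by
    apply intervalIntegral.integral_congr
    intro x hx
    rw [uIcc_of_le hle] at hx
    simp only [hg', h3 x hx]
  rw [e1, key, e2]
  ring

/-- Squared norm of a Fourier coefficient of a real function, by real integrals. -/
lemma fc_norm {θ : ℝ} (h0 : 0 < θ) (hab : -θ < θ) (f : ℝ → ℝ)
    (hf : IntervalIntegrable f volume (-θ) θ) (n : ℤ) :
    ‖fourierCoeffOn hab (fun x => (f x : ℂ)) n‖ ^ 2 = (1 / (2 * θ)) ^ 2 *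
      ((∫ x in (-θ)..θ, Real.cos (n * π / θ * x) * f x) ^ 2 +
        (∫ x in (-θ)..θ, Real.sin (n * π / θ * x) * f x) ^ 2) := by
  rw [fourierCoeffOn_eq_integral]
  have i1 : IntervalIntegrable (fun x => Real.cos (n * π / θ * x) * f x) volume (-θ) θ :=
    hf.continuousOn_mul (by fun_prop)
  have i2 : IntervalIntegrable (fun x => Real.sin (n * π / θ * x) * f x) volume (-θ) θ :=
    hf.continuousOn_mul (by fun_prop)
  have e : ∫ x in (-θ)..θ, fourier (-n) (x : AddCircle (θ - -θ)) • (f x : ℂ) =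
      ((∫ x in (-θ)..θ, Real.cos (n * π / θ * x) * f x : ℝ) : ℂ) -
        ((∫ x in (-θ)..θ, Real.sin (n * π / θ * x) * f x : ℝ) : ℂ) * Complex.I := by
    rw [← intervalIntegral.integral_ofReal, ← intervalIntegral.integral_ofReal,
      ← intervalIntegral.integral_mul_const, ← intervalIntegral.integral_sub]
    · apply intervalIntegral.integral_congr
      intro x _
      have : (2 * π * Complex.I * ((-n : ℤ) : ℂ) * x / ((θ - -θ : ℝ) : ℂ)) =
          ((-(n * π / θ * x) : ℝ) : ℂ) * Complex.I := by
        have : (θ : ℂ) ≠ 0 := by exact_mod_cast h0.ne'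
        push_cast
        rw [sub_neg_eq_add, ← two_mul]
        field_simp
      simp only [fourier_coe_apply, this, Complex.exp_mul_I, smul_eq_mul]
      rw [← Complex.ofReal_cos, ← Complex.ofReal_sin, Real.cos_neg, Real.sin_neg]
      push_cast
      ring
    · exact ⟨i1.1.ofReal, i1.2.ofReal⟩
    · exact IntervalIntegrable.mul_const ⟨i2.1.ofReal, i2.2.ofReal⟩ _
  rw [e, norm_smul, mul_pow, ← Complex.normSq_eq_norm_sq]
  have : ∀ a b : ℝ, Complex.normSq ((a : ℂ) - b * Complex.I) = a ^ 2 + b ^ 2 := by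
    intro a b
    simp [Complex.normSq_apply]
    ring
  rw [this, Real.norm_eq_abs, sq_abs, sub_neg_eq_add, ← two_mul]

/-- Wirtinger's inequality on `(-θ,θ)`. -/
lemma wirtinger_mean {θ : ℝ} {u u' : ℝ → ℝ} (h0 : 0 < θ) (hu : MemW120 θ u u') :
    (π / θ) ^ 2 * ((∫ t in (-θ)..θ, (u t) ^ 2) - (∫ t in (-θ)..θ, u t) ^ 2 / (2 * θ)) ≤
      ∫ t in (-θ)..θ, (u' t) ^ 2 := by
  have hab : -θ < θ := by linarith
  have hle := hab.le
  have hu1 := hu.1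
  have hu2 := hu.2.1
  have hcont : ContinuousOn u (Icc (-θ) θ) := by
    have hac := (hu1.absolutelyContinuousOnInterval_intervalIntegral
      (c := -θ) left_mem_uIcc).continuousOn
    rw [uIcc_of_le hle] at hac
    exact hac.congr hu.2.2.1
  have hui : IntervalIntegrable u volume (-θ) θ :=
    ContinuousOn.intervalIntegrable (by rwa [uIcc_of_le hle])
  have husq : IntervalIntegrable (fun t => u t ^ 2) volume (-θ) θ :=
    ContinuousOn.intervalIntegrable (by rw [uIcc_of_le hle]; exact hcont.pow 2)
  have toL2 : ∀ f : ℝ → ℝ, IntervalIntegrable f volume (-θ) θ →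
      IntervalIntegrable (fun t => f t ^ 2) volume (-θ) θ →
      HasSum (fun i => ‖fourierCoeffOn hab (fun x => (f x : ℂ)) i‖ ^ 2)
        ((2 * θ)⁻¹ * ∫ x in (-θ)..θ, f x ^ 2) := by
    intro f h1 h2
    rw [intervalIntegrable_iff_integrableOn_Ioc_of_le hle] at h1 h2
    have hm : MemLp f 2 (volume.restrict (Ioc (-θ) θ)) :=
      (memLp_two_iff_integrable_sq h1.aestronglyMeasurable).2 h2
    have := hasSum_sq_fourierCoeffOn hab hm.ofReal
    simpa [sub_neg_eq_add, ← two_mul] using this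
  have s1 := toL2 u hui husq
  have s2 := toL2 u' hu1 hu2
  have s3 := hasSum_ite_eq (0 : ℤ) (‖fourierCoeffOn hab (fun x => (u x : ℂ)) 0‖ ^ 2)
  have s4 := (s1.sub s3).mul_left ((π / θ) ^ 2)
  have hcmp := hasSum_le (fun n => ?_) s4 s2
  · rw [fc_norm h0 hab u hui 0] at hcmp
    simp only [Int.cast_zero, zero_mul, zero_div, Real.cos_zero, Real.sin_zero, one_mul,
      intervalIntegral.integral_zero] at hcmp
    generalize (∫ x in (-θ)..θ, u x ^ 2) = A at hcmp ⊢
    generalize (∫ x in (-θ)..θ, u' x ^ 2) = D at hcmp ⊢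
    generalize (∫ x in (-θ)..θ, u x) = B at hcmp ⊢
    have h := mul_le_mul_of_nonneg_left hcmp (by positivity : 0 ≤ 2 * θ)
    have e1 : 2 * θ * ((2 * θ)⁻¹ * D) = D := by field_simp
    have e2 : 2 * θ * ((π / θ) ^ 2 * ((2 * θ)⁻¹ * A - (1 / (2 * θ)) ^ 2 * (B ^ 2 + 0 ^ 2))) =
        (π / θ) ^ 2 * (A - B ^ 2 / (2 * θ)) := by
      rw [zero_pow two_ne_zero, add_zero]
      field_simp
    rw [e1] at h
    exact e2 ▸ h
  · by_cases hn : n = 0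
    · subst hn
      simp
    · simp only [hn, if_false, sub_zero]
      rw [fc_norm h0 hab u hui n, fc_norm h0 hab u' hu1 n]
      have p1 := memW_parts h0 hu (fun x => Real.cos (n * π / θ * x))
        (fun x => (n * π / θ) * (-Real.sin (n * π / θ * x))) (by fun_prop) (by
          funext x
          have := ((hasDerivAt_id x).const_mul (n * π / θ)).cos
          simp only [id, mul_one] at this
          rw [this.deriv]; ring)
      have p2 := memW_parts h0 hu (fun x => Real.sin (n * π / θ * x))
        (fun x => (n * π / θ) * (Real.cos (n * π / θ * x))) (by fun_prop) (by
          funext x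
          have := ((hasDerivAt_id x).const_mul (n * π / θ)).sin
          simp only [id, mul_one] at this
          rw [this.deriv]; ring)
      simp only [mul_assoc, neg_mul, mul_neg, intervalIntegral.integral_neg,
        intervalIntegral.integral_const_mul] at p1 p2
      simp only [mul_div_assoc, mul_assoc, intervalIntegral.integral_const_mul] at p1 p2 ⊢
      rw [p1, p2]
      generalize (∫ x in (-θ)..θ, Real.cos (n * (π / θ * x)) * u x) = C
      generalize (∫ x in (-θ)..θ, Real.sin (n * (π / θ * x)) * u x) = S
      have hn2 : (1 : ℝ) ≤ (n : ℝ) ^ 2 := by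
        have : (1 : ℤ) ≤ n ^ 2 := by
          have := sq_pos_of_ne_zero hn
          omega
        exact_mod_cast this
      have hp : 0 ≤ (π / θ) ^ 2 * ((1 / (2 * θ)) ^ 2 * (C ^ 2 + S ^ 2)) := by positivity
      nlinarith [mul_le_mul_of_nonneg_right hn2 hp]

theorem stmt6 (lam θ M : ℝ) (hlam : lam ∈ Set.Ioo (0:ℝ) 1)
    (hθ : θ ∈ Set.Ioo 0 π) (hM : 0 < M) (u u' : ℝ → ℝ)
    (hu : MemW120 θ u u')
    (hmean : (∫ t in (-θ)..θ, u t)^2 ≤ (1/M) * ∫ t in (-θ)..θ, (u t)^2) :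
    (1 - lam) * (∫ t in (-θ)..θ, (u' t)^2) - (∫ t in (-θ)..θ, (u t)^2) ≥
      (π/θ) * ((π/θ)*(1 - lam) - θ/π - π*(1 - lam)/(2*θ^2*M)) *
        ∫ t in (-θ)..θ, (u t)^2 := by
  obtain ⟨h0, -⟩ := hθ
  have hw := wirtinger_mean h0 hu
  have hl : 0 < 1 - lam := by linarith [hlam.2]
  set A := ∫ t in (-θ)..θ, (u t)^2
  set B := ∫ t in (-θ)..θ, u t
  set D := ∫ t in (-θ)..θ, (u' t)^2
  have h1 : (π / θ) ^ 2 * (A - (1 / M * A) / (2 * θ)) ≤ D := by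
    refine le_trans ?_ hw
    gcongr
  have h2 := mul_le_mul_of_nonneg_left h1 hl.le
  have e : (π/θ) * ((π/θ)*(1 - lam) - θ/π - π*(1 - lam)/(2*θ^2*M)) * A =
      (1 - lam) * ((π / θ) ^ 2 * (A - (1 / M * A) / (2 * θ))) - A := by
    have := Real.pi_pos.ne'
    field_simp
    ring
  rw [ge_iff_le, e]
  linarith
end
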